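/- Fix λ > 1, r > 0, T > 0. For every s < 0, p > 1 and ε > 0 there exists a constant C_ε > 0, not depending on N, such that for every integer N ≥ 1 and every N-finite random solution (Ω, F, P, U) with parameter r: P( ω : (∫_0^T ‖U(ω,t)‖_{H^s}^p dt)^{1/p} ≤ C_ε ) > 1 − ε. -/

import Mathlib

open MeasureTheory ProbabilityTheory

/-- Coefficients of the N-dimensional shell model. -/
noncomputable def shellK (lam : ℝ) (N : ℕ) (n : ℕ) : ℝ :=
  if 1 < n ∧ n < N then lam ^ n else 0

/-- A solution of the `N`-dimensional shell model on `[0,T]`, conventions `X_0 ≡ 0`,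
`X_{N+1} ≡ 0`. -/
def IsShellSolution (lam : ℝ) (N : ℕ) (T : ℝ) (X : ℝ → ℕ → ℝ) : Prop :=
  (∀ t, X t 0 = 0) ∧ (∀ t, X t (N + 1) = 0) ∧
  ∀ n, 1 ≤ n → n ≤ N → ∀ t ∈ Set.Icc (0 : ℝ) T,
    HasDerivWithinAt (fun u => X u n)
      (shellK lam N n * (X t (n - 1)) ^ 2
        - shellK lam N (n + 1) * X t n * X t (n + 1)
        - shellK lam N n * (X t (n + 1)) ^ 2
        + shellK lam N (n - 1) * X t (n - 1) * X t n)
      (Set.Icc (0 : ℝ) T) t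

/-- An `N`-finite random solution with parameter `r > 0`. -/
def IsNFiniteRandomSolution (lam T r : ℝ) (N : ℕ) {Ω : Type*} [MeasurableSpace Ω]
    (P : Measure Ω) (U : Ω → ℝ → ℕ → ℝ) : Prop :=
  Measurable (fun p : Ω × ℝ => U p.1 p.2) ∧
  (∀ ω t, ∀ n, N < n → U ω t n = 0) ∧
  (∀ ω, IsShellSolution lam N T (U ω)) ∧
  Measure.map (fun ω => fun i : Fin N => U ω 0 ((i : ℕ) + 1)) P
    = Measure.pi fun _ : Fin N => gaussianReal 0 (r ^ 2).toNNReal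

/-- The `H^s` norm of a sequence (component `n ≥ 1` is `x n`):
`‖x‖_{H^s} = ( ∑_{n≥1} λ^{2sn} x_n² )^{1/2}`. -/
noncomputable def Hnorm (lam s : ℝ) (x : ℕ → ℝ) : ℝ :=
  Real.sqrt (∑' n : ℕ, lam ^ (2 * s * ((n : ℝ) + 1)) * (x (n + 1)) ^ 2)

/-- `b` is Lipschitz on every ball. -/
def LipschitzOnBalls {V : Type*} [NormedAddCommGroup V] (b : V → V) : Prop :=
  ∀ R : ℝ, ∃ K : ℝ, 0 ≤ K ∧ ∀ x y : V, ‖x‖ ≤ R → ‖y‖ ≤ R → ‖b x - b y‖ ≤ K * ‖x - y‖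

/-- The one-step method `E` has local error `O(h²)` for `x' = b x`, uniformly on balls. -/
def IsConsistentScheme {V : Type*} [NormedAddCommGroup V] [NormedSpace ℝ V]
    (E : ℝ → V → V) (b : V → V) : Prop :=
  ∀ R : ℝ, ∃ C : ℝ, 0 ≤ C ∧ ∃ δ : ℝ, 0 < δ ∧ ∀ h, 0 ≤ h → h ≤ δ → ∀ x : V, ‖x‖ ≤ R →
    ‖E h x - x - h • b x‖ ≤ C * h ^ 2

section Scheme

variable {V : Type*} [NormedAddCommGroup V]

theorem LipschitzOnBalls.add {b b' : V → V} (hb : LipschitzOnBalls b)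
    (hb' : LipschitzOnBalls b') : LipschitzOnBalls (fun x => b x + b' x) := by
  intro R
  obtain ⟨K, hK, h⟩ := hb R
  obtain ⟨K', hK', h'⟩ := hb' R
  refine ⟨K + K', by positivity, fun x y hx hy => ?_⟩
  calc ‖b x + b' x - (b y + b' y)‖ = ‖(b x - b y) + (b' x - b' y)‖ := by congr 1; abel
    _ ≤ ‖b x - b y‖ + ‖b' x - b' y‖ := norm_add_le _ _
    _ ≤ K * ‖x - y‖ + K' * ‖x - y‖ := add_le_add (h x y hx hy) (h' x y hx hy)
    _ = (K + K') * ‖x - y‖ := by ring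

theorem LipschitzOnBalls.exists_norm_le {b : V → V} (hb : LipschitzOnBalls b) (R : ℝ) :
    ∃ B : ℝ, 0 ≤ B ∧ ∀ x, ‖x‖ ≤ R → ‖b x‖ ≤ B := by
  obtain ⟨K, hK, h⟩ := hb |R|
  refine ⟨‖b 0‖ + K * |R|, by positivity, fun x hx => ?_⟩
  have hx' : ‖x‖ ≤ |R| := hx.trans (le_abs_self R)
  have h1 := h x 0 hx' (by simp)
  rw [sub_zero] at h1
  calc ‖b x‖ = ‖b 0 + (b x - b 0)‖ := by congr 1; abel
    _ ≤ ‖b 0‖ + ‖b x - b 0‖ := norm_add_le _ _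
    _ ≤ ‖b 0‖ + K * |R| := by
        have := mul_le_mul_of_nonneg_left hx' hK
        linarith

variable [NormedSpace ℝ V]

theorem ContDiff.lipschitzOnBalls [ProperSpace V] {b : V → V} (hb : ContDiff ℝ 1 b) :
    LipschitzOnBalls b := by
  intro R
  obtain ⟨K, hK⟩ := hb.contDiffOn.exists_lipschitzOnWith (s := Metric.closedBall 0 R) one_ne_zero
    (convex_closedBall 0 R) (isCompact_closedBall 0 R)
  refine ⟨K, K.2, fun x y hx hy => ?_⟩
  simpa [dist_eq_norm] using hK.dist_le_mul x (by simpa using hx) y (by simpa using hy)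

theorem IsConsistentScheme.comp {E E' : ℝ → V → V} {b b' : V → V} (hE : IsConsistentScheme E b)
    (hE' : IsConsistentScheme E' b') (hb : LipschitzOnBalls b) (hb' : LipschitzOnBalls b') :
    IsConsistentScheme (fun h => E' h ∘ E h) (fun x => b x + b' x) := by
  intro R
  obtain ⟨C, hC, δ, hδ, h1⟩ := hE R
  obtain ⟨B, hB, hB'⟩ := hb.exists_norm_le R
  obtain ⟨C', hC', δ', hδ', h2⟩ := hE' (R + 1)
  obtain ⟨K, hK, hK'⟩ := hb' (R + 1)
  refine ⟨C' + C + K * (C + B), by positivity, min (min δ δ') (min 1 (1 / (C + B + 1))),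
    by positivity, fun h h0 hh x hx => ?_⟩
  have hδ1 : h ≤ δ := hh.trans ((min_le_left _ _).trans (min_le_left _ _))
  have hδ2 : h ≤ δ' := hh.trans ((min_le_left _ _).trans (min_le_right _ _))
  have hh1 : h ≤ 1 := hh.trans ((min_le_right _ _).trans (min_le_left _ _))
  have hh2 : h ≤ 1 / (C + B + 1) := hh.trans ((min_le_right _ _).trans (min_le_right _ _))
  rw [le_div_iff₀ (by positivity)] at hh2
  have e1 := h1 h h0 hδ1 x hx
  have hyx : ‖E h x - x‖ ≤ h * (C + B) := by
    calc ‖E h x - x‖ = ‖(E h x - x - h • b x) + h • b x‖ := by congr 1; abel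
      _ ≤ C * h ^ 2 + h * B := by
        refine (norm_add_le _ _).trans (add_le_add e1 ?_)
        rw [norm_smul, Real.norm_of_nonneg h0]
        exact mul_le_mul_of_nonneg_left (hB' x hx) h0
      _ ≤ h * (C + B) := by nlinarith [mul_nonneg hC h0]
  have hy : ‖E h x‖ ≤ R + 1 := by
    calc ‖E h x‖ = ‖x + (E h x - x)‖ := by congr 1; abel
      _ ≤ R + h * (C + B) := (norm_add_le _ _).trans (add_le_add hx hyx)
      _ ≤ R + 1 := by nlinarith
  have e2 := h2 h h0 hδ2 (E h x) hy
  have e3 := hK' (E h x) x hy (by linarith)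
  calc ‖(E' h ∘ E h) x - x - h • (b x + b' x)‖
      = ‖(E' h (E h x) - E h x - h • b' (E h x)) + (E h x - x - h • b x)
          + h • (b' (E h x) - b' x)‖ := by
        simp only [Function.comp, smul_add, smul_sub]
        congr 1; abel
    _ ≤ C' * h ^ 2 + C * h ^ 2 + h * (K * (h * (C + B))) := by
        refine (norm_add_le _ _).trans (add_le_add ((norm_add_le _ _).trans (add_le_add e2 e1)) ?_)
        rw [norm_smul, Real.norm_of_nonneg h0]
        gcongr
        exact e3.trans (mul_le_mul_of_nonneg_left hyx hK)
    _ = _ := by ring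

/-- Local truncation error of the explicit Euler step along a solution. -/
theorem norm_sub_sub_smul_le_of_hasDerivWithinAt {b : V → V} {X : ℝ → V} {T R B K : ℝ}
    (hX : ∀ t ∈ Set.Icc (0 : ℝ) T, HasDerivWithinAt X (b (X t)) (Set.Icc 0 T) t)
    (hR : ∀ t ∈ Set.Icc (0 : ℝ) T, ‖X t‖ ≤ R) (hB : ∀ x, ‖x‖ ≤ R → ‖b x‖ ≤ B) (hK0 : 0 ≤ K)
    (hK : ∀ x y, ‖x‖ ≤ R → ‖y‖ ≤ R → ‖b x - b y‖ ≤ K * ‖x - y‖)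
    {t h : ℝ} (ht : 0 ≤ t) (h0 : 0 ≤ h) (hth : t + h ≤ T) :
    ‖X (t + h) - X t - h • b (X t)‖ ≤ K * B * h ^ 2 := by
  have hsub : Set.Icc t (t + h) ⊆ Set.Icc 0 T := Set.Icc_subset_Icc ht hth
  have htm : t ∈ Set.Icc 0 T := ⟨ht, by linarith⟩
  have hlip : ∀ s ∈ Set.Icc t (t + h), ‖X s - X t‖ ≤ B * h := by
    intro s hs
    have := (convex_Icc (0 : ℝ) T).norm_image_sub_le_of_norm_hasDerivWithin_le hX
      (fun u hu => hB _ (hR u hu)) htm (hsub hs)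
    refine this.trans ?_
    have hB0 : 0 ≤ B := (norm_nonneg _).trans (hB _ (hR t htm))
    refine mul_le_mul_of_nonneg_left ?_ hB0
    rw [Real.norm_of_nonneg (by linarith [hs.1])]
    linarith [hs.2]
  have hd : ∀ s ∈ Set.Icc t (t + h),
      HasDerivWithinAt (fun s => X s - s • b (X t)) (b (X s) - b (X t)) (Set.Icc t (t + h)) s := by
    intro s hs
    have h1 := (hX s (hsub hs)).mono hsub
    have h2 : HasDerivWithinAt (fun s : ℝ => s • b (X t)) ((1 : ℝ) • b (X t))
        (Set.Icc t (t + h)) s := (hasDerivWithinAt_id s _).smul_const _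
    rw [one_smul] at h2
    exact h1.sub h2
  have key := (convex_Icc t (t + h)).norm_image_sub_le_of_norm_hasDerivWithin_le hd
    (C := K * (B * h)) (fun s hs => (hK _ _ (hR s (hsub hs)) (hR t htm)).trans
      (mul_le_mul_of_nonneg_left (hlip s hs) hK0))
    (Set.left_mem_Icc.2 (by linarith)) (Set.right_mem_Icc.2 (by linarith : t ≤ t + h))
  rw [add_sub_cancel_left, Real.norm_of_nonneg h0] at key
  calc _ = ‖X (t + h) - (t + h) • b (X t) - (X t - t • b (X t))‖ := by
        rw [add_smul]; congr 1; abel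
    _ ≤ K * (B * h) * h := key
    _ = _ := by ring

/-- A consistent one-step method converges along every solution. -/
theorem IsConsistentScheme.tendsto_iterate {E : ℝ → V → V} {b : V → V}
    (hE : IsConsistentScheme E b) (hb : LipschitzOnBalls b) {X : ℝ → V} {T : ℝ} (hT : 0 ≤ T)
    (hX : ∀ t ∈ Set.Icc (0 : ℝ) T, HasDerivWithinAt X (b (X t)) (Set.Icc 0 T) t) :
    Filter.Tendsto (fun n : ℕ => (E (T / (n + 1)))^[n + 1] (X 0)) Filter.atTop (nhds (X T)) := by
  have hcont : ContinuousOn X (Set.Icc 0 T) := fun t ht => (hX t ht).continuousWithinAt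
  obtain ⟨M, hM⟩ := isCompact_Icc.exists_bound_of_continuousOn hcont
  obtain ⟨C, hC, δ, hδ, hcons⟩ := hE (M + 1)
  obtain ⟨B, hB0, hB⟩ := hb.exists_norm_le (M + 1)
  obtain ⟨K, hK0, hK⟩ := hb (M + 1)
  set D := C + K * B with hD
  have hD0 : 0 ≤ D := by positivity
  have hlim : Filter.Tendsto (fun n : ℕ => T / ((n : ℝ) + 1)) Filter.atTop (nhds 0) := by
    simpa [div_eq_mul_inv] using tendsto_one_div_add_atTop_nhds_zero_nat.const_mul T
  have hlim2 : Filter.Tendsto (fun n : ℕ => D * (T / ((n : ℝ) + 1)) * T * Real.exp (K * T))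
      Filter.atTop (nhds 0) := by
    simpa using ((hlim.const_mul D).mul_const T).mul_const (Real.exp (K * T))
  rw [tendsto_iff_norm_sub_tendsto_zero]
  refine squeeze_zero_norm' ?_ hlim2
  filter_upwards [hlim.eventually_le_const hδ, hlim2.eventually_le_const one_pos] with n hn1 hn2
  set h := T / ((n : ℝ) + 1) with hh
  have h0 : 0 ≤ h := by positivity
  have hT' : ((n + 1 : ℕ) : ℝ) * h = T := by
    push_cast; rw [hh]; field_simp
  have main : ∀ k : ℕ, k ≤ n + 1 →
      ‖(E h)^[k] (X 0) - X (k * h)‖ ≤ D * h * (k * h) * Real.exp (K * (k * h)) := by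
    intro k
    induction k with
    | zero => simp
    | succ k ih =>
      intro hk
      have ih' := ih (by omega)
      have hkT : (k : ℝ) * h + h ≤ T := by
        rw [← hT']
        have : ((k + 1 : ℕ) : ℝ) ≤ ((n + 1 : ℕ) : ℝ) := by exact_mod_cast hk
        calc (k : ℝ) * h + h = ((k + 1 : ℕ) : ℝ) * h := by push_cast; ring
          _ ≤ _ := mul_le_mul_of_nonneg_right this h0
      have hk0 : 0 ≤ (k : ℝ) * h := by positivity
      have hkm : (k : ℝ) * h ∈ Set.Icc 0 T := ⟨hk0, by linarith⟩
      have hbd : ‖(E h)^[k] (X 0) - X (k * h)‖ ≤ 1 := by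
        refine ih'.trans (le_trans ?_ hn2)
        have : (k : ℝ) * h ≤ T := hkm.2
        gcongr
      set y := (E h)^[k] (X 0)
      have hXk := hM _ hkm
      have hy : ‖y‖ ≤ M + 1 := by
        calc ‖y‖ = ‖X (k * h) + (y - X (k * h))‖ := by congr 1; abel
          _ ≤ M + 1 := (norm_add_le _ _).trans (add_le_add hXk hbd)
      have e1 := hcons h h0 hn1 y hy
      have e2 := norm_sub_sub_smul_le_of_hasDerivWithinAt hX (R := M + 1)
        (fun t ht => (hM t ht).trans (by linarith)) hB hK0 hK hk0 h0 hkT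
      have e3 := hK y (X (k * h)) hy (by linarith)
      rw [Function.iterate_succ_apply']
      have hcast : ((k + 1 : ℕ) : ℝ) * h = k * h + h := by push_cast; ring
      rw [hcast]
      set d := ‖y - X (k * h)‖
      calc ‖E h y - X (k * h + h)‖
          = ‖(E h y - y - h • b y) - (X (k * h + h) - X (k * h) - h • b (X (k * h)))
              + ((y - X (k * h)) + h • (b y - b (X (k * h))))‖ := by
            rw [smul_sub]; congr 1; abel
        _ ≤ (C * h ^ 2 + K * B * h ^ 2) + (d + h * (K * d)) := by
            refine (norm_add_le _ _).trans (add_le_add ((norm_sub_le _ _).trans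
              (add_le_add e1 e2)) ((norm_add_le _ _).trans (add_le_add le_rfl ?_)))
            rw [norm_smul, Real.norm_of_nonneg h0]
            exact mul_le_mul_of_nonneg_left e3 h0
        _ = D * h ^ 2 + (1 + K * h) * d := by rw [hD]; ring
        _ ≤ D * h ^ 2 * Real.exp (K * (k * h + h))
              + Real.exp (K * h) * (D * h * (k * h) * Real.exp (K * (k * h))) := by
            have : 1 ≤ Real.exp (K * (k * h + h)) := Real.one_le_exp (by positivity)
            have h3 : 1 + K * h ≤ Real.exp (K * h) := by
              linarith [Real.add_one_le_exp (K * h)]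
            refine add_le_add (le_mul_of_one_le_right (by positivity) this) ?_
            exact mul_le_mul h3 ih' (norm_nonneg _) (Real.exp_pos _).le
        _ = D * h * (k * h + h) * Real.exp (K * (k * h + h)) := by
            rw [mul_add K, Real.exp_add]; ring
  have := main (n + 1) le_rfl
  rw [hT'] at this
  simpa using this

end Scheme

section VolumePreserving

open scoped ENNReal

theorem lintegral_comp_mul_add_mul_abs {a : ℝ} (ha : a ≠ 0) (c : ℝ) {F : ℝ → ℝ≥0∞}
    (hF : Measurable F) : ∫⁻ t, F (a * t + c) * ENNReal.ofReal |a| = ∫⁻ t, F t := by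
  calc ∫⁻ t, F (a * t + c) * ENNReal.ofReal |a|
      = ENNReal.ofReal |a| * ∫⁻ t, F (a * t + c) := by
        rw [lintegral_mul_const _ (by fun_prop), mul_comm]
    _ = ∫⁻ t, F (t + c) ∂(ENNReal.ofReal |a| • Measure.map (a * ·) volume) := by
        rw [lintegral_smul_measure, lintegral_map (by fun_prop) (by fun_prop), smul_eq_mul]
    _ = ∫⁻ t, F t := by
        rw [Real.smul_map_volume_mul_left ha, lintegral_add_right_eq_self]

variable {ι : Type*} [Fintype ι]

/-- `b` is a locally Lipschitz vector field whose flow is approximated by a consistent one-step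
method that preserves Lebesgue measure. -/
def HasVolumePreservingScheme (b : (ι → ℝ) → (ι → ℝ)) : Prop :=
  LipschitzOnBalls b ∧ ∃ E : ℝ → (ι → ℝ) → (ι → ℝ), IsConsistentScheme E b ∧
    ∀ h, MeasurePreserving (E h) volume volume

theorem HasVolumePreservingScheme.zero : HasVolumePreservingScheme (fun _ : ι → ℝ => 0) :=
  ⟨fun _ => ⟨0, le_rfl, by simp⟩, fun _ => id,
    fun _ => ⟨0, le_rfl, 1, one_pos, by simp⟩, fun _ => MeasurePreserving.id _⟩

theorem HasVolumePreservingScheme.add {b b' : (ι → ℝ) → (ι → ℝ)}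
    (hb : HasVolumePreservingScheme b) (hb' : HasVolumePreservingScheme b') :
    HasVolumePreservingScheme (fun x => b x + b' x) := by
  obtain ⟨hl, E, hc, hp⟩ := hb
  obtain ⟨hl', E', hc', hp'⟩ := hb'
  exact ⟨hl.add hl', fun h => E' h ∘ E h, hc.comp hc' hl hl', fun h => (hp' h).comp (hp h)⟩

theorem HasVolumePreservingScheme.sum {κ : Type*} (s : Finset κ) {b : κ → (ι → ℝ) → (ι → ℝ)}
    (hb : ∀ j ∈ s, HasVolumePreservingScheme (b j)) :
    HasVolumePreservingScheme (fun x => ∑ j ∈ s, b j x) := by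
  classical
  induction s using Finset.induction_on with
  | empty => simpa using HasVolumePreservingScheme.zero
  | insert j s hj ih =>
    simp only [Finset.sum_insert hj]
    exact (hb j (Finset.mem_insert_self j s)).add
      (ih fun i hi => hb i (Finset.mem_insert_of_mem hi))

variable [DecidableEq ι]

/-- Change of variables for a map that acts affinely on the coordinate `i`, with coefficients
depending only on the other coordinates. -/
theorem lintegral_update_affine (i : ι) {a g : (ι → ℝ) → ℝ} (ha : Measurable a)
    (hg : Measurable g) (ha0 : ∀ x, a x ≠ 0) (hai : ∀ x t, a (Function.update x i t) = a x)
    (hgi : ∀ x t, g (Function.update x i t) = g x) {f : (ι → ℝ) → ℝ≥0∞} (hf : Measurable f) :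
    ∫⁻ x, f (Function.update x i (a x * x i + g x)) * ENNReal.ofReal |a x| = ∫⁻ x, f x := by
  have hm : Measurable fun x : ι → ℝ => Function.update x i (a x * x i + g x) := by
    refine measurable_pi_lambda _ fun j => ?_
    by_cases hj : j = i
    · subst hj; simpa using by fun_prop
    · simpa [hj] using measurable_pi_apply j
  rw [volume_pi]
  refine lintegral_eq_of_lmarginal_eq {i} ((hf.comp hm).mul (by fun_prop)) hf ?_
  rw [lmarginal_singleton, lmarginal_singleton]
  funext x
  simp only [hai, hgi, Function.update_self, Function.update_idem]
  exact lintegral_comp_mul_add_mul_abs (ha0 x) (g x)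
    (F := fun t => f (Function.update x i t)) (by fun_prop)

theorem measurePreserving_update_add (i : ι) {g : (ι → ℝ) → ℝ} (hg : Measurable g)
    (hgi : ∀ x t, g (Function.update x i t) = g x) :
    MeasurePreserving (fun x : ι → ℝ => Function.update x i (x i + g x)) volume volume := by
  have hm : Measurable fun x : ι → ℝ => Function.update x i (x i + g x) := by
    refine measurable_pi_lambda _ fun j => ?_
    by_cases hj : j = i
    · subst hj; simpa using by fun_prop
    · simpa [hj] using measurable_pi_apply j
  refine ⟨hm, Measure.ext fun s hs => ?_⟩
  rw [← lintegral_indicator_one hs, ← lintegral_indicator_one hs,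
    lintegral_map (measurable_one.indicator hs) hm]
  simpa using lintegral_update_affine i (a := fun _ => 1) measurable_const hg (by simp) (by simp)
    hgi (measurable_one.indicator hs)

/-- Expanding one coordinate and contracting another by the same factor preserves volume. -/
theorem measurePreserving_update_exp_mul {a c : ι} (hac : a ≠ c) {g : (ι → ℝ) → ℝ}
    (hg : Measurable g) (hga : ∀ x t, g (Function.update x a t) = g x)
    (hgc : ∀ x t, g (Function.update x c t) = g x) :
    MeasurePreserving (fun x : ι → ℝ => Function.update
      (Function.update x a (Real.exp (-g x) * x a)) c (Real.exp (g x) * x c)) volume volume := by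
  have hm : Measurable fun x : ι → ℝ => Function.update
      (Function.update x a (Real.exp (-g x) * x a)) c (Real.exp (g x) * x c) := by
    refine measurable_pi_lambda _ fun j => ?_
    by_cases hj : j = c
    · subst hj; simpa using by fun_prop
    · by_cases hj' : j = a
      · subst hj'; simpa [hj] using by fun_prop
      · simpa [hj, hj'] using measurable_pi_apply j
  refine ⟨hm, Measure.ext fun s hs => ?_⟩
  have hf : Measurable (s.indicator (1 : (ι → ℝ) → ℝ≥0∞)) := measurable_one.indicator hs
  rw [← lintegral_indicator_one hs, ← lintegral_indicator_one hs, lintegral_map hf hm]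
  have hm' : Measurable fun x : ι → ℝ => Function.update x c (Real.exp (g x) * x c) := by
    refine measurable_pi_lambda _ fun j => ?_
    by_cases hj : j = c
    · subst hj; simpa using by fun_prop
    · simpa [hj] using measurable_pi_apply j
  have h1 := lintegral_update_affine c (a := fun x => Real.exp (g x)) (g := fun _ => 0)
    (by fun_prop) measurable_const (fun x => (Real.exp_pos _).ne') (by simp [hgc]) (by simp) hf
  have h2 := lintegral_update_affine a (a := fun x => Real.exp (-g x)) (g := fun _ => 0)
    (f := fun x => s.indicator 1 (Function.update x c (Real.exp (g x) * x c + 0)) *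
      ENNReal.ofReal |Real.exp (g x)|)
    (by fun_prop) measurable_const (fun x => (Real.exp_pos _).ne') (by simp [hga]) (by simp)
    (by simp only [add_zero]; exact (hf.comp hm').mul (by fun_prop))
  rw [← h1, ← h2]
  refine lintegral_congr fun x => ?_
  simp only [add_zero, hga, Function.update_of_ne hac.symm, abs_of_pos (Real.exp_pos _)]
  rw [mul_assoc, ← ENNReal.ofReal_mul (Real.exp_pos _).le, ← Real.exp_add, add_neg_cancel,
    Real.exp_zero, ENNReal.ofReal_one, mul_one]

theorem HasVolumePreservingScheme.shear (i : ι) {g : (ι → ℝ) → ℝ} (hg : ContDiff ℝ 1 g)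
    (hgi : ∀ x t, g (Function.update x i t) = g x) :
    HasVolumePreservingScheme (fun x => Pi.single i (g x)) := by
  refine ⟨ContDiff.lipschitzOnBalls ?_, fun h x => Function.update x i (x i + h * g x),
    fun R => ⟨0, le_rfl, 1, one_pos, fun h _ _ x _ => ?_⟩, fun h =>
      measurePreserving_update_add i (hg.continuous.measurable.const_mul h) fun x t => by rw [hgi]⟩
  · rw [contDiff_pi]
    intro j
    by_cases hj : j = i
    · subst hj; simpa using hg
    · simpa [hj] using contDiff_const
  · have : Function.update x i (x i + h * g x) - x - h • Pi.single i (g x) = 0 := by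
      funext j
      by_cases hj : j = i
      · subst hj; simp
      · simp [hj]
    simp [this]

theorem HasVolumePreservingScheme.hyperbolic {a c : ι} (hac : a ≠ c) {g : (ι → ℝ) → ℝ}
    (hg : ContDiff ℝ 1 g) (hga : ∀ x t, g (Function.update x a t) = g x)
    (hgc : ∀ x t, g (Function.update x c t) = g x) :
    HasVolumePreservingScheme
      (fun x => Pi.single a (-(g x * x a)) + Pi.single c (g x * x c)) := by
  refine ⟨ContDiff.lipschitzOnBalls ?_, fun h x => Function.update
      (Function.update x a (Real.exp (-(h * g x)) * x a)) c (Real.exp (h * g x) * x c),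
    fun R => ?_, fun h => measurePreserving_update_exp_mul hac (g := fun x => h * g x)
      (hg.continuous.measurable.const_mul h) (fun x t => by rw [hga]) (fun x t => by rw [hgc])⟩
  · have hs : ∀ (i : ι) (u : (ι → ℝ) → ℝ), ContDiff ℝ 1 u →
        ContDiff ℝ 1 (fun x => (Pi.single i (u x) : ι → ℝ)) := by
      intro i u hu
      rw [contDiff_pi]
      intro j
      by_cases hj : j = i
      · subst hj; simpa using hu
      · simpa [hj] using contDiff_const
    exact (hs a _ (by fun_prop)).add (hs c _ (by fun_prop))
  · obtain ⟨G, hG⟩ := (isCompact_closedBall (0 : ι → ℝ) R).exists_bound_of_continuousOn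
      hg.continuous.continuousOn
    refine ⟨G ^ 2 * |R|, by positivity, 1 / (|G| + 1), by positivity, fun h h0 hh x hx => ?_⟩
    have hgx : |g x| ≤ G := hG x (by simpa using hx)
    have hG0 : 0 ≤ G := (abs_nonneg _).trans hgx
    rw [abs_of_nonneg hG0, le_div_iff₀ (by positivity)] at hh
    have hz : |h * g x| ≤ h * G := by
      rw [abs_mul, abs_of_nonneg h0]; exact mul_le_mul_of_nonneg_left hgx h0
    have hz1 : |h * g x| ≤ 1 := by nlinarith
    have hsq : (h * g x) ^ 2 ≤ h ^ 2 * G ^ 2 := by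
      rw [← sq_abs, ← mul_pow]; gcongr
    have hxR : ∀ j, |x j| ≤ |R| := fun j => (norm_le_pi_norm x j).trans (hx.trans (le_abs_self R))
    have est : ∀ z : ℝ, |z| ≤ 1 → z ^ 2 ≤ h ^ 2 * G ^ 2 → ∀ j,
        |(Real.exp z - 1 - z) * x j| ≤ G ^ 2 * |R| * h ^ 2 := by
      intro z h1 h2 j
      rw [abs_mul]
      calc _ ≤ (h ^ 2 * G ^ 2) * |R| :=
            mul_le_mul ((Real.abs_exp_sub_one_sub_id_le h1).trans h2) (hxR j) (abs_nonneg _)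
              (by positivity)
        _ = _ := by ring
    rw [pi_norm_le_iff_of_nonneg (by positivity)]
    intro j
    rw [Real.norm_eq_abs]
    by_cases hj : j = c
    · subst hj
      convert est (h * g x) hz1 hsq j using 2
      simp [hac.symm]; ring
    · by_cases hj' : j = a
      · subst hj'
        convert est (-(h * g x)) (by rwa [abs_neg]) (by rwa [neg_sq]) j using 2
        simp [hj]; ring
      · simp [hj, hj']; positivity

end VolumePreserving

section Gaussian

open scoped ENNReal NNReal

variable {ι : Type*} [Fintype ι]

theorem volume_eq_pi_gaussianReal_withDensity {v : ℝ≥0} (hv : v ≠ 0) :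
    (volume : Measure (ι → ℝ)) = (Measure.pi fun _ : ι => gaussianReal 0 v).withDensity
      fun x => ∏ i, (gaussianPDF 0 v (x i))⁻¹ := by
  rw [volume_pi]
  refine Measure.pi_eq fun s hs => ?_
  have hm : ∀ i, Measurable ((s i).indicator fun t => (gaussianPDF 0 v t)⁻¹) := fun i =>
    (measurable_gaussianPDF 0 v).inv.indicator (hs i)
  have hprod : ∀ x : ι → ℝ, (Set.univ.pi s).indicator (fun x => ∏ i, (gaussianPDF 0 v (x i))⁻¹) x
      = ∏ i, (s i).indicator (fun t => (gaussianPDF 0 v t)⁻¹) (x i) := by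
    intro x
    by_cases hx : x ∈ Set.univ.pi s
    · rw [Set.indicator_of_mem hx]
      exact Finset.prod_congr rfl fun i _ => by
        rw [Set.indicator_of_mem (hx i (Set.mem_univ i))]
    · rw [Set.indicator_of_notMem hx]
      simp only [Set.mem_pi, Set.mem_univ, true_imp_iff, not_forall] at hx
      obtain ⟨i, hi⟩ := hx
      exact (Finset.prod_eq_zero (Finset.mem_univ i) (Set.indicator_of_notMem hi _)).symm
  rw [withDensity_apply _ (MeasurableSet.univ_pi hs),
    ← lintegral_indicator (MeasurableSet.univ_pi hs)]
  simp_rw [hprod]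
  rw [lintegral_prod_eq_prod_lintegral_of_indepFun Finset.univ
    (fun i (x : ι → ℝ) => (s i).indicator (fun t => (gaussianPDF 0 v t)⁻¹) (x i))
    (iIndepFun_pi fun i => (hm i).aemeasurable) fun i => (hm i).comp (measurable_pi_apply i)]
  refine Finset.prod_congr rfl fun i _ => ?_
  rw [(measurePreserving_eval (fun _ : ι => gaussianReal 0 v) i).lintegral_comp (hm i),
    gaussianReal_of_var_ne_zero 0 hv,
    lintegral_withDensity_eq_lintegral_mul _ (measurable_gaussianPDF 0 v) (hm i),
    ← lintegral_indicator_one (hs i)]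
  refine lintegral_congr fun t => ?_
  by_cases ht : t ∈ s i
  · simp only [Pi.mul_apply, Set.indicator_of_mem ht, Pi.one_apply]
    exact ENNReal.mul_inv_cancel (gaussianPDF_pos 0 hv t).ne' gaussianPDF_ne_top
  · simp [Set.indicator_of_notMem ht]

theorem lintegral_pi_gaussianReal_mul_inv {v : ℝ≥0} (hv : v ≠ 0) {F : (ι → ℝ) → ℝ≥0∞}
    (hF : Measurable F) :
    ∫⁻ x, F x * ∏ i, (gaussianPDF 0 v (x i))⁻¹ ∂(Measure.pi fun _ : ι => gaussianReal 0 v)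
      = ∫⁻ x, F x := by
  have hm : Measurable fun x : ι → ℝ => ∏ i, (gaussianPDF 0 v (x i))⁻¹ :=
    Finset.measurable_prod _ fun i _ =>
      ((measurable_gaussianPDF 0 v).comp (measurable_pi_apply i)).inv
  rw [volume_eq_pi_gaussianReal_withDensity hv, lintegral_withDensity_eq_lintegral_mul _ hm hF]
  simp only [Pi.mul_apply, mul_comm]

theorem prod_gaussianPDFReal_eq_of_sum_sq_eq (v : ℝ≥0) {x y : ι → ℝ}
    (h : ∑ i, x i ^ 2 = ∑ i, y i ^ 2) :
    ∏ i, gaussianPDFReal 0 v (x i) = ∏ i, gaussianPDFReal 0 v (y i) := by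
  simp only [gaussianPDFReal, sub_zero, Finset.prod_mul_distrib, ← Real.exp_sum,
    ← Finset.sum_div, Finset.sum_neg_distrib, h]

/-- Conservation of energy along the solutions of a vector field orthogonal to the position. -/
theorem sum_sq_eq_of_hasDerivWithinAt {b : (ι → ℝ) → (ι → ℝ)}
    (hb : ∀ x, ∑ i, x i * b x i = 0) {X : ℝ → ι → ℝ} {T : ℝ} (hT : 0 ≤ T)
    (hX : ∀ t ∈ Set.Icc (0 : ℝ) T, HasDerivWithinAt X (b (X t)) (Set.Icc 0 T) t) :
    ∑ i, X T i ^ 2 = ∑ i, X 0 i ^ 2 := by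
  have hd : ∀ t ∈ Set.Icc (0 : ℝ) T,
      HasDerivWithinAt (fun t => ∑ i, X t i ^ 2) 0 (Set.Icc 0 T) t := by
    intro t ht
    have h1 : HasDerivWithinAt (fun t => ∑ i, X t i ^ 2)
        (∑ i, 2 * (X t i * b (X t) i)) (Set.Icc 0 T) t := by
      refine HasDerivWithinAt.fun_sum fun i _ => ?_
      exact ((hasDerivWithinAt_pi.1 (hX t ht) i).fun_pow 2).congr_deriv (by simp [mul_assoc])
    rwa [← Finset.mul_sum, hb, mul_zero] at h1
  have key := (convex_Icc (0 : ℝ) T).norm_image_sub_le_of_norm_hasDerivWithin_le hd (C := 0)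
    (by simp) (Set.left_mem_Icc.2 hT) (Set.right_mem_Icc.2 hT)
  rw [zero_mul, norm_le_zero_iff, sub_eq_zero] at key
  exact key

theorem continuous_prod_gaussianPDFReal (v : ℝ≥0) :
    Continuous fun x : ι → ℝ => ∏ i, gaussianPDFReal 0 v (x i) := by
  unfold gaussianPDFReal
  fun_prop

theorem HasVolumePreservingScheme.lintegral_le_pi_gaussianReal {b : (ι → ℝ) → (ι → ℝ)}
    (hb : HasVolumePreservingScheme b) (horth : ∀ x, ∑ i, x i * b x i = 0)
    {v : ℝ≥0} (hv : v ≠ 0) {Ω : Type*} [MeasurableSpace Ω] {P : Measure Ω}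
    {V : Ω → ℝ → ι → ℝ} (hV0 : Measurable fun ω => V ω 0)
    (hlaw : P.map (fun ω => V ω 0) = Measure.pi fun _ : ι => gaussianReal 0 v)
    {T : ℝ} (hT : 0 ≤ T) (hV : ∀ ω, ∀ t ∈ Set.Icc (0 : ℝ) T,
      HasDerivWithinAt (V ω) (b (V ω t)) (Set.Icc 0 T) t)
    {f : (ι → ℝ) → ℝ} (hf : Continuous f) (hf0 : ∀ x, 0 ≤ f x) :
    ∫⁻ ω, ENNReal.ofReal (f (V ω T)) ∂P
      ≤ ∫⁻ x, ENNReal.ofReal (f x) ∂(Measure.pi fun _ : ι => gaussianReal 0 v) := by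
  obtain ⟨hlip, E, hcons, hpres⟩ := hb
  set ρ : (ι → ℝ) → ℝ := fun x => ∏ i, gaussianPDFReal 0 v (x i) with hρ
  have hρc : Continuous ρ := continuous_prod_gaussianPDFReal v
  have hρpos : ∀ x, 0 < ρ x := fun x =>
    Finset.prod_pos fun i _ => gaussianPDFReal_pos 0 v (x i) hv
  have hρinv : ∀ x, (ENNReal.ofReal (ρ x))⁻¹ = ∏ i, (gaussianPDF 0 v (x i))⁻¹ := by
    intro x
    rw [hρ, ENNReal.ofReal_prod_of_nonneg fun i _ => gaussianPDFReal_nonneg 0 v (x i)]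
    exact ENNReal.prod_inv_distrib
      fun i _ j _ _ => Or.inl (gaussianPDF_pos 0 hv (x i)).ne'
  have hcancel : ∀ x, ENNReal.ofReal (f x * ρ x) * (ENNReal.ofReal (ρ x))⁻¹
      = ENNReal.ofReal (f x) := by
    intro x
    rw [ENNReal.ofReal_mul (hf0 x), mul_assoc, ENNReal.mul_inv_cancel
      (ENNReal.ofReal_pos.2 (hρpos x)).ne' ENNReal.ofReal_ne_top, mul_one]
  set F : (ι → ℝ) → ℝ≥0∞ := fun x => ENNReal.ofReal (f x * ρ x) with hF
  have hFc : Continuous F := ENNReal.continuous_ofReal.comp (hf.mul hρc)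
  have hgm : Measurable fun x => (ENNReal.ofReal (ρ x))⁻¹ :=
    (ENNReal.measurable_ofReal.comp hρc.measurable).inv
  let S : ℕ → (ι → ℝ) → (ι → ℝ) := fun n => (E (T / (n + 1)))^[n + 1]
  have hS : ∀ n, MeasurePreserving (S n) volume volume := fun n => (hpres _).iterate _
  have hstep : ∀ n, ∫⁻ ω, F (S n (V ω 0)) * (ENNReal.ofReal (ρ (V ω 0)))⁻¹ ∂P = ∫⁻ x, F x := by
    intro n
    have hm : Measurable fun x => F (S n x) := hFc.measurable.comp (hS n).measurable
    rw [← (hS n).lintegral_comp hFc.measurable, ← lintegral_pi_gaussianReal_mul_inv hv hm, ← hlaw,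
      lintegral_map (by simp only [← hρinv]; exact hm.mul hgm) hV0]
    simp only [hρinv]
  calc ∫⁻ ω, ENNReal.ofReal (f (V ω T)) ∂P
      = ∫⁻ ω, Filter.liminf
          (fun n => F (S n (V ω 0)) * (ENNReal.ofReal (ρ (V ω 0)))⁻¹) Filter.atTop ∂P := by
        refine lintegral_congr fun ω => ?_
        have hρeq : ρ (V ω T) = ρ (V ω 0) :=
          prod_gaussianPDFReal_eq_of_sum_sq_eq v (sum_sq_eq_of_hasDerivWithinAt horth hT (hV ω))
        have hlim := ENNReal.Tendsto.mul_const (b := (ENNReal.ofReal (ρ (V ω 0)))⁻¹)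
          ((hFc.tendsto _).comp (hcons.tendsto_iterate hlip hT (hV ω)))
          (Or.inr (ENNReal.inv_ne_top.2 (ENNReal.ofReal_pos.2 (hρpos _)).ne'))
        have hF0 : ENNReal.ofReal (f (V ω T))
            = F (V ω T) * (ENNReal.ofReal (ρ (V ω 0)))⁻¹ := by
          rw [← hρeq]
          exact (hcancel _).symm
        rw [hF0]
        exact hlim.liminf_eq.symm
    _ ≤ Filter.liminf (fun n => ∫⁻ ω, F (S n (V ω 0)) * (ENNReal.ofReal (ρ (V ω 0)))⁻¹ ∂P)
          Filter.atTop :=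
        lintegral_liminf_le fun n => (hFc.measurable.comp ((hS n).measurable.comp hV0)).mul
          (hgm.comp hV0)
    _ = ∫⁻ x, F x := by simp only [hstep, Filter.liminf_const]
    _ = ∫⁻ x, ENNReal.ofReal (f x) ∂(Measure.pi fun _ : ι => gaussianReal 0 v) := by
        rw [← lintegral_pi_gaussianReal_mul_inv hv hFc.measurable]
        simp only [← hρinv, hF, hcancel]

end Gaussian

section Shell

/-- The coordinates of `x`, numbered from `1` to `N` and extended by zero. -/
noncomputable def shellExtend {N : ℕ} (x : Fin N → ℝ) (m : ℕ) : ℝ :=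
  if h : 1 ≤ m ∧ m ≤ N then x ⟨m - 1, by omega⟩ else 0

/-- The vector field of the shell model on `ℝ^N`. -/
noncomputable def shellField (lam : ℝ) {N : ℕ} (x : Fin N → ℝ) : Fin N → ℝ := fun i =>
  shellK lam N (i + 1) * shellExtend x i ^ 2
    - shellK lam N (i + 2) * x i * shellExtend x (i + 2)
    - shellK lam N (i + 1) * shellExtend x (i + 2) ^ 2
    + shellK lam N i * shellExtend x i * x i

/-- The part of the shell model that couples the shells `n - 1`, `n`, `n + 1`. -/
noncomputable def shellTriad (lam : ℝ) {N : ℕ} (n : ℕ) (x : Fin N → ℝ) : Fin N → ℝ :=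
  if h : 1 < n ∧ n < N then
    Pi.single ⟨n - 1, by omega⟩ (lam ^ n * (x ⟨n - 2, by omega⟩ ^ 2 - x ⟨n, h.2⟩ ^ 2))
      + (Pi.single ⟨n - 2, by omega⟩ (-(lam ^ n * x ⟨n - 1, by omega⟩ * x ⟨n - 2, by omega⟩))
        + Pi.single ⟨n, h.2⟩ (lam ^ n * x ⟨n - 1, by omega⟩ * x ⟨n, h.2⟩))
  else 0

theorem shellTriad_apply (lam : ℝ) {N : ℕ} (n : ℕ) (x : Fin N → ℝ) (i : Fin N) :
    shellTriad lam n x i =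
      (if i + 1 = n then
        shellK lam N (i + 1) * (shellExtend x i ^ 2 - shellExtend x (i + 2) ^ 2) else 0)
      + ((if i + 2 = n then -(shellK lam N (i + 2) * shellExtend x (i + 2) * x i) else 0)
        + (if i = n then shellK lam N i * shellExtend x i * x i else 0)) := by
  obtain ⟨i, hi⟩ := i
  unfold shellTriad
  by_cases h : 1 < n ∧ n < N
  · rw [dif_pos h]
    simp only [Pi.add_apply, Pi.single_apply, Fin.mk.injEq]
    congr 1
    · by_cases h1 : i + 1 = n
      · subst h1
        have h2 : 1 ≤ i ∧ i ≤ N := by omega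
        have h3 : 1 ≤ i + 2 ∧ i + 2 ≤ N := by omega
        simp [shellK, shellExtend, h, h2, h3]
      · rw [if_neg h1, if_neg (by omega)]
    congr 1
    · by_cases h1 : i + 2 = n
      · subst h1
        have h3 : 1 ≤ i + 2 ∧ i + 2 ≤ N := by omega
        simp [shellK, shellExtend, h, h3]
      · rw [if_neg h1, if_neg (by omega)]
    · by_cases h1 : i = n
      · subst h1
        have h2 : 1 ≤ i ∧ i ≤ N := by omega
        simp [shellK, shellExtend, h, h2]
      · rw [if_neg h1, if_neg (by omega)]
  · rw [dif_neg h]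
    have hk : shellK lam N n = 0 := if_neg h
    split_ifs with h1 h2 h3 h2 h3 h3 <;> first | omega | simp_all

theorem shellField_eq_sum (lam : ℝ) {N : ℕ} (x : Fin N → ℝ) :
    shellField lam x = ∑ n ∈ Finset.range (N + 2), shellTriad lam n x := by
  funext i
  rw [Finset.sum_apply]
  simp only [shellTriad_apply, Finset.sum_add_distrib, Finset.sum_ite_eq, Finset.mem_range]
  have hi := i.2
  rw [if_pos (by omega), if_pos (by omega), if_pos (by omega), shellField]
  ring

theorem hasVolumePreservingScheme_shellField (lam : ℝ) (N : ℕ) :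
    HasVolumePreservingScheme (shellField lam : (Fin N → ℝ) → Fin N → ℝ) := by
  have hfield : (shellField lam : (Fin N → ℝ) → Fin N → ℝ)
      = fun x => ∑ n ∈ Finset.range (N + 2), shellTriad lam n x :=
    funext fun x => shellField_eq_sum lam x
  rw [hfield]
  refine HasVolumePreservingScheme.sum _ fun n _ => ?_
  by_cases h : 1 < n ∧ n < N
  · unfold shellTriad
    simp only [dif_pos h]
    have hne : ∀ {p q : ℕ} (hp : p < N) (hq : q < N), p ≠ q → (⟨p, hp⟩ : Fin N) ≠ ⟨q, hq⟩ :=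
      fun _ _ hpq heq => hpq (Fin.mk.inj_iff.1 heq)
    refine (HasVolumePreservingScheme.shear _ (by fun_prop) fun x t => ?_).add
      (HasVolumePreservingScheme.hyperbolic (hne _ _ (by omega))
        (g := fun x => lam ^ n * x ⟨n - 1, by omega⟩) (by fun_prop) (fun x t => ?_) fun x t => ?_)
    · rw [Function.update_of_ne (hne _ _ (by omega)), Function.update_of_ne (hne _ _ (by omega))]
    · rw [Function.update_of_ne (hne _ _ (by omega))]
    · rw [Function.update_of_ne (hne _ _ (by omega))]
  · unfold shellTriad
    simp only [dif_neg h]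
    exact HasVolumePreservingScheme.zero

theorem sum_mul_shellField (lam : ℝ) {N : ℕ} (x : Fin N → ℝ) :
    ∑ i, x i * shellField lam x i = 0 := by
  simp only [shellField_eq_sum, Finset.sum_apply, Finset.mul_sum]
  rw [Finset.sum_comm]
  refine Finset.sum_eq_zero fun n _ => ?_
  unfold shellTriad
  split_ifs with h
  · simp only [Pi.add_apply, Pi.single_apply, mul_add, mul_ite, mul_zero, Finset.sum_add_distrib,
      Finset.sum_ite_eq', Finset.mem_univ, if_true]
    ring
  · simp

theorem IsShellSolution.hasDerivWithinAt {lam T : ℝ} {N : ℕ} {X : ℝ → ℕ → ℝ}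
    (hX : IsShellSolution lam N T X) {t : ℝ} (ht : t ∈ Set.Icc (0 : ℝ) T) :
    HasDerivWithinAt (fun u (i : Fin N) => X u (i + 1))
      (shellField lam fun i : Fin N => X t (i + 1)) (Set.Icc 0 T) t := by
  obtain ⟨h0, hN, hd⟩ := hX
  have hext : ∀ m, m ≤ N + 1 → shellExtend (fun i : Fin N => X t (i + 1)) m = X t m := by
    intro m hm
    unfold shellExtend
    split_ifs with h
    · simp only; congr 1; omega
    · obtain rfl | rfl : m = 0 ∨ m = N + 1 := by omega
      · rw [h0]
      · rw [hN]
  rw [hasDerivWithinAt_pi]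
  intro i
  have hi := i.2
  refine (hd (i + 1) (by omega) (by omega) t ht).congr_deriv ?_
  simp only [shellField, hext i (by omega), hext (i + 2) (by omega), Nat.add_sub_cancel]

end Shell

section Moments

open scoped ENNReal NNReal

/-- The weight of the component `n + 1` in the squared `H^s` norm. -/
noncomputable def sobolevWeight (lam s : ℝ) (n : ℕ) : ℝ := lam ^ (2 * s * ((n : ℝ) + 1))

theorem sobolevWeight_pos {lam : ℝ} (hlam : 1 < lam) (s : ℝ) (n : ℕ) :
    0 < sobolevWeight lam s n :=
  Real.rpow_pos_of_pos (by linarith) _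

theorem summable_sobolevWeight {lam s : ℝ} (hlam : 1 < lam) (hs : s < 0) :
    Summable (sobolevWeight lam s) := by
  have hl : 0 < lam := by linarith
  have hr : lam ^ (2 * s) < 1 := Real.rpow_lt_one_of_one_lt_of_neg hlam (by linarith)
  have h := (summable_geometric_of_lt_one (Real.rpow_nonneg hl.le _) hr).mul_right (lam ^ (2 * s))
  refine h.congr fun n => ?_
  rw [sobolevWeight, ← pow_succ, ← Real.rpow_natCast, ← Real.rpow_mul hl.le]
  push_cast
  rfl

theorem Hnorm_eq_sqrt_sum (lam s : ℝ) {N : ℕ} {x : ℕ → ℝ} (hx : ∀ n, N < n → x n = 0) :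
    Hnorm lam s x = √(∑ i : Fin N, sobolevWeight lam s i * x (i + 1) ^ 2) := by
  rw [Hnorm, tsum_eq_sum (s := Finset.range N), Finset.sum_range]
  · rfl
  · intro n hn
    rw [Finset.mem_range, not_lt] at hn
    rw [hx (n + 1) (by omega)]
    simp

theorem sqrt_rpow_le_one_add_pow {y p : ℝ} (hy : 0 ≤ y) (hp : 0 ≤ p) {m : ℕ}
    (hm : p ≤ 2 * m) : √y ^ p ≤ 1 + y ^ m := by
  rcases le_total (√y) 1 with h | h
  · have := Real.rpow_le_one (Real.sqrt_nonneg y) h hp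
    have := pow_nonneg hy m
    linarith
  · have h1 : √y ^ p ≤ √y ^ (2 * (m : ℝ)) := Real.rpow_le_rpow_of_exponent_le h hm
    have h2 : √y ^ (2 * (m : ℝ)) = y ^ m := by
      rw [show 2 * (m : ℝ) = ((2 * m : ℕ) : ℝ) by push_cast; ring, Real.rpow_natCast, pow_mul,
        Real.sq_sqrt hy]
    linarith

/-- A polynomial majorant of the `p`-th power of the `H^s` norm of an `N`-dimensional state. -/
noncomputable def normMajorant (lam s : ℝ) (m N : ℕ) (x : Fin N → ℝ) : ℝ :=
  1 + (∑ i : Fin N, sobolevWeight lam s i) ^ m *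
    ∑ i : Fin N, sobolevWeight lam s i / (∑ j : Fin N, sobolevWeight lam s j) * x i ^ (2 * m)

theorem sum_sobolevWeight_pos {lam : ℝ} (hlam : 1 < lam) (s : ℝ) {N : ℕ} (hN : 1 ≤ N) :
    0 < ∑ i : Fin N, sobolevWeight lam s i :=
  Finset.sum_pos (fun i _ => sobolevWeight_pos hlam s i) ⟨⟨0, hN⟩, Finset.mem_univ _⟩

theorem sum_sobolevWeight_div {lam : ℝ} (hlam : 1 < lam) (s : ℝ) {N : ℕ} (hN : 1 ≤ N) :
    ∑ i : Fin N, sobolevWeight lam s i / (∑ j : Fin N, sobolevWeight lam s j) = 1 := by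
  rw [← Finset.sum_div, div_self (sum_sobolevWeight_pos hlam s hN).ne']

theorem Hnorm_rpow_le_normMajorant {lam : ℝ} (hlam : 1 < lam) (s : ℝ) {p : ℝ} (hp : 0 ≤ p)
    {m : ℕ} (hm : p ≤ 2 * m) {N : ℕ} (hN : 1 ≤ N) {x : ℕ → ℝ} (hx : ∀ n, N < n → x n = 0) :
    Hnorm lam s x ^ p ≤ normMajorant lam s m N (fun i => x (i + 1)) := by
  have hS := sum_sobolevWeight_pos hlam s hN
  rw [Hnorm_eq_sqrt_sum lam s hx, normMajorant]
  have hy : 0 ≤ ∑ i : Fin N, sobolevWeight lam s i * x (i + 1) ^ 2 :=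
    Finset.sum_nonneg fun i _ => mul_nonneg (sobolevWeight_pos hlam s i).le (sq_nonneg _)
  refine (sqrt_rpow_le_one_add_pow hy hp hm).trans ?_
  have hmean := Real.pow_arith_mean_le_arith_mean_pow Finset.univ
    (fun i : Fin N => sobolevWeight lam s i / (∑ j : Fin N, sobolevWeight lam s j))
    (fun i => x (i + 1) ^ 2) (fun i _ => div_nonneg (sobolevWeight_pos hlam s i).le hS.le)
    (sum_sobolevWeight_div hlam s hN) (fun i _ => sq_nonneg _) m
  have hsum : ∑ i : Fin N, sobolevWeight lam s i * x (i + 1) ^ 2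
      = (∑ j : Fin N, sobolevWeight lam s j) *
        ∑ i : Fin N, sobolevWeight lam s i / (∑ j : Fin N, sobolevWeight lam s j)
          * x (i + 1) ^ 2 := by
    rw [Finset.mul_sum]
    refine Finset.sum_congr rfl fun i _ => ?_
    field_simp
  rw [hsum, mul_pow]
  simp only [pow_mul]
  gcongr

theorem normMajorant_nonneg {lam : ℝ} (hlam : 1 < lam) (s : ℝ) (m N : ℕ) (x : Fin N → ℝ) :
    0 ≤ normMajorant lam s m N x := by
  have hw : ∀ i : Fin N, 0 ≤ sobolevWeight lam s i := fun i => (sobolevWeight_pos hlam s i).le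
  have hS : 0 ≤ ∑ i : Fin N, sobolevWeight lam s i := Finset.sum_nonneg fun i _ => hw i
  refine add_nonneg zero_le_one (mul_nonneg (pow_nonneg hS m) (Finset.sum_nonneg fun i _ => ?_))
  refine mul_nonneg (div_nonneg (hw i) hS) ?_
  rw [pow_mul]
  exact pow_nonneg (sq_nonneg _) m

theorem continuous_normMajorant (lam s : ℝ) (m N : ℕ) :
    Continuous (normMajorant lam s m N) := by
  unfold normMajorant
  fun_prop

theorem lintegral_normMajorant_le {lam s : ℝ} (hlam : 1 < lam) (hs : s < 0) (m : ℕ) {N : ℕ}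
    (hN : 1 ≤ N) (v : ℝ≥0) :
    ∫⁻ x, ENNReal.ofReal (normMajorant lam s m N x)
        ∂(Measure.pi fun _ : Fin N => gaussianReal 0 v)
      ≤ ENNReal.ofReal
        (1 + (∑' n, sobolevWeight lam s n) ^ m * ∫ t, t ^ (2 * m) ∂(gaussianReal 0 v)) := by
  have hInt1 : Integrable (fun t : ℝ => t ^ (2 * m)) (gaussianReal 0 v) := by
    have h := (memLp_id_gaussianReal' (μ := 0) (v := v) ((2 * m : ℕ) : ℝ≥0∞)
      (ENNReal.natCast_ne_top _)).integrable_norm_pow'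
    refine h.congr (Filter.Eventually.of_forall fun t => ?_)
    simp [pow_mul]
  have hInt : ∀ i : Fin N, Integrable (fun x : Fin N → ℝ => x i ^ (2 * m))
      (Measure.pi fun _ : Fin N => gaussianReal 0 v) := fun i =>
    ((measurePreserving_eval (fun _ : Fin N => gaussianReal 0 v) i).integrable_comp
      hInt1.aestronglyMeasurable).2 hInt1
  have hev : ∀ i : Fin N, ∫ x : Fin N → ℝ, x i ^ (2 * m)
      ∂(Measure.pi fun _ : Fin N => gaussianReal 0 v) = ∫ t, t ^ (2 * m) ∂(gaussianReal 0 v) :=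
    fun i => integral_comp_eval (μ := fun _ : Fin N => gaussianReal 0 v) (i := i)
      (f := fun t => t ^ (2 * m)) hInt1.aestronglyMeasurable
  have hsumint : Integrable (fun x : Fin N → ℝ => (∑ i : Fin N, sobolevWeight lam s i) ^ m *
      ∑ i : Fin N, sobolevWeight lam s i / (∑ j : Fin N, sobolevWeight lam s j) * x i ^ (2 * m))
      (Measure.pi fun _ : Fin N => gaussianReal 0 v) :=
    (integrable_finsetSum _ fun i _ => (hInt i).const_mul _).const_mul _
  have hI : Integrable (normMajorant lam s m N)
      (Measure.pi fun _ : Fin N => gaussianReal 0 v) := (integrable_const 1).add hsumint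
  rw [← ofReal_integral_eq_lintegral_ofReal hI
    (Filter.Eventually.of_forall (normMajorant_nonneg hlam s m N))]
  refine ENNReal.ofReal_le_ofReal ?_
  unfold normMajorant
  rw [integral_add (integrable_const 1) hsumint, integral_const_mul,
    integral_finsetSum _ fun i _ => (hInt i).const_mul _]
  simp only [integral_const_mul, hev]
  rw [← Finset.sum_mul, sum_sobolevWeight_div hlam s hN, one_mul]
  have hM : 0 ≤ ∫ t, t ^ (2 * m) ∂(gaussianReal 0 v) :=
    integral_nonneg fun t => by simp only [pow_mul]; positivity
  have hle : ∑ i : Fin N, sobolevWeight lam s i ≤ ∑' n, sobolevWeight lam s n := by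
    rw [← Finset.sum_range (sobolevWeight lam s)]
    exact (summable_sobolevWeight hlam hs).sum_le_tsum _
      fun n _ => (sobolevWeight_pos hlam s n).le
  have hS := (sum_sobolevWeight_pos hlam s hN).le
  simp only [integral_const, probReal_univ, one_smul]
  gcongr

theorem IsNFiniteRandomSolution.lintegral_le {lam T r : ℝ} (hr : 0 < r) {N : ℕ} {Ω : Type*}
    [MeasurableSpace Ω] {P : Measure Ω} {U : Ω → ℝ → ℕ → ℝ}
    (hU : IsNFiniteRandomSolution lam T r N P U) {t : ℝ} (ht : t ∈ Set.Icc (0 : ℝ) T)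
    {f : (Fin N → ℝ) → ℝ} (hf : Continuous f) (hf0 : ∀ x, 0 ≤ f x) :
    ∫⁻ ω, ENNReal.ofReal (f fun i => U ω t (i + 1)) ∂P
      ≤ ∫⁻ x, ENNReal.ofReal (f x)
        ∂(Measure.pi fun _ : Fin N => gaussianReal 0 (r ^ 2).toNNReal) := by
  obtain ⟨hmeas, -, hsol, hlaw⟩ := hU
  have hv : (r ^ 2).toNNReal ≠ 0 := (Real.toNNReal_pos.2 (by positivity)).ne'
  refine (hasVolumePreservingScheme_shellField lam N).lintegral_le_pi_gaussianReal
    (V := fun ω u i => U ω u (i + 1)) (sum_mul_shellField lam) hv ?_ hlaw ht.1 ?_ hf hf0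
  · exact measurable_pi_lambda _ fun i =>
      (measurable_pi_apply _).comp (hmeas.comp (measurable_id.prodMk measurable_const))
  · intro ω u hu
    have hsub : Set.Icc 0 t ⊆ Set.Icc 0 T := Set.Icc_subset_Icc_right ht.2
    exact ((hsol ω).hasDerivWithinAt (hsub hu)).mono hsub

end Moments

/-- uniform-in-`N` bound in probability for the `L^p(0,T;H^s)` norm of
`N`-finite random solutions: for every `s < 0`, `p > 1`, `ε > 0` there is `C_ε > 0`,
independent of `N`, with `P( ‖U‖_{L^p(0,T;H^s)} ≤ C_ε ) > 1 − ε`. -/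
theorem nfinite_random_solution_Lp_bound (lam r T : ℝ) (hlam : 1 < lam) (hr : 0 < r)
    (hT : 0 < T) (s p ε : ℝ) (hs : s < 0) (hp : 1 < p) (hε : 0 < ε) :
    ∃ C : ℝ, 0 < C ∧
      ∀ (N : ℕ), 1 ≤ N → ∀ (Ω : Type*) (_ : MeasurableSpace Ω) (P : Measure Ω)
        (_ : IsProbabilityMeasure P) (U : Ω → ℝ → ℕ → ℝ),
        IsNFiniteRandomSolution lam T r N P U →
        1 - ε <
          (P {ω | (∫ t in (0 : ℝ)..T, Hnorm lam s (U ω t) ^ p) ^ (1 / p) ≤ C}).toReal := by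
  obtain ⟨m, hm⟩ := exists_nat_ge (p / 2)
  have hpm : p ≤ 2 * m := by linarith
  have hp0 : 0 < p := by linarith
  set K : ℝ := 1 + (∑' n, sobolevWeight lam s n) ^ m *
    ∫ t, t ^ (2 * m) ∂(gaussianReal 0 (r ^ 2).toNNReal) with hK
  have hK0 : 0 ≤ K := by
    have h1 : 0 ≤ ∑' n, sobolevWeight lam s n :=
      tsum_nonneg fun n => (sobolevWeight_pos hlam s n).le
    have h2 : 0 ≤ ∫ t, t ^ (2 * m) ∂(gaussianReal 0 (r ^ 2).toNNReal) :=
      integral_nonneg fun t => by simp only [pow_mul]; positivity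
    positivity
  have hKT : 0 ≤ K * T := by positivity
  set a : ℝ := (K * T + 1) / ε with ha
  have ha0 : 0 < a := by positivity
  refine ⟨a ^ (1 / p), Real.rpow_pos_of_pos ha0 _, fun N hN Ω _ P _ U hU => ?_⟩
  have hmeas := hU.1
  let G : Ω → ℝ → ENNReal := fun ω t =>
    ENNReal.ofReal (normMajorant lam s m N fun i => U ω t (i + 1))
  have hG : Measurable (Function.uncurry G) := by
    refine ENNReal.measurable_ofReal.comp ((continuous_normMajorant lam s m N).measurable.comp ?_)
    exact measurable_pi_lambda _ fun i => (measurable_pi_apply _).comp hmeas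
  let J : Ω → ENNReal := fun ω => ∫⁻ t in Set.Ioc 0 T, G ω t
  have hJ : Measurable J := hG.lintegral_prod_right'
  have hEJ : ∫⁻ ω, J ω ∂P ≤ ENNReal.ofReal (K * T) := by
    calc ∫⁻ ω, J ω ∂P = ∫⁻ t in Set.Ioc 0 T, ∫⁻ ω, G ω t ∂P :=
          lintegral_lintegral_swap hG.aemeasurable
      _ ≤ ∫⁻ _ in Set.Ioc 0 T, ENNReal.ofReal K :=
          setLIntegral_mono measurable_const fun t ht =>
            (hU.lintegral_le hr (Set.Ioc_subset_Icc_self ht) (continuous_normMajorant lam s m N)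
              (normMajorant_nonneg hlam s m N)).trans (lintegral_normMajorant_le hlam hs m hN _)
      _ = ENNReal.ofReal (K * T) := by
          rw [setLIntegral_const, Real.volume_Ioc, sub_zero, ← ENNReal.ofReal_mul hK0]
  set good := {ω | (∫ t in (0 : ℝ)..T, Hnorm lam s (U ω t) ^ p) ^ (1 / p) ≤ a ^ (1 / p)}
  have hcover : Set.univ ⊆ good ∪ {ω | ENNReal.ofReal a ≤ J ω} := by
    intro ω _
    by_cases hω : ENNReal.ofReal a ≤ J ω
    · exact Or.inr hω
    refine Or.inl ?_
    have hH0 : ∀ t, 0 ≤ Hnorm lam s (U ω t) ^ p := fun t =>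
      Real.rpow_nonneg (Real.sqrt_nonneg _) _
    refine Real.rpow_le_rpow (intervalIntegral.integral_nonneg hT.le fun t _ => hH0 t) ?_
      (by positivity)
    rw [intervalIntegral.integral_of_le hT.le]
    refine (Real.le_norm_self _).trans ((norm_integral_le_lintegral_norm _).trans ?_)
    refine ENNReal.toReal_le_of_le_ofReal ha0.le (le_trans ?_ (not_le.1 hω).le)
    refine lintegral_mono fun t => ENNReal.ofReal_le_ofReal ?_
    rw [Real.norm_of_nonneg (hH0 t)]
    exact Hnorm_rpow_le_normMajorant hlam s hp0.le hpm hN (hU.2.1 ω t)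
  have hbad : P.real {ω | ENNReal.ofReal a ≤ J ω} ≤ K * T / a := by
    refine ENNReal.toReal_le_of_le_ofReal (by positivity) ?_
    rw [ENNReal.ofReal_div_of_pos ha0]
    exact (meas_ge_le_lintegral_div hJ.aemeasurable (ENNReal.ofReal_pos.2 ha0).ne'
      ENNReal.ofReal_ne_top).trans (ENNReal.div_le_div_right hEJ _)
  have hlt : K * T / a < ε := by
    rw [div_lt_iff₀ ha0, ha, mul_div_cancel₀ _ hε.ne']
    linarith
  have h1 : 1 ≤ P.real good + P.real {ω | ENNReal.ofReal a ≤ J ω} := by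
    rw [← probReal_univ (μ := P)]
    exact (measureReal_mono hcover).trans (measureReal_union_le _ _)
  change 1 - ε < P.real good
  linarith
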